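/- Let Ω ⊂ ℝⁿ be a domain and let λ > 0 be such that for every 0 < λ' ≤ λ the sets bmo_{λ'}(Ω) and bmo_λ(Ω) coincide. Then for f ∈ bmo_λ(Ω) the following four conditions are equivalent: (a) lim_{t→0⁺} ω_Ω(f,t) = 0; (b) there exist bounded uniformly continuous functions g_j on Ω with ‖f − g_j‖_{bmo_λ(Ω)} → 0; (c) there exist bounded Lipschitz functions g_j on Ω with ‖f − g_j‖_{bmo_λ(Ω)} → 0; (d) there exist bounded Lipschitz functions g_j on Ω with dist(supp g_j, ∂Ω) > 0 and ‖f − g_j‖_{bmo_λ(Ω)} → 0. -/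

import Mathlib

open MeasureTheory Metric Filter Topology

noncomputable section

/-- A closed axis-parallel cube in ℝⁿ: a closed ball in the sup norm with
positive radius (`half` = half the sidelength). -/
structure Cube (n : ℕ) where
  center : Fin n → ℝ
  half : ℝ
  half_pos : 0 < half

namespace Cube

variable {n : ℕ}

/-- The underlying set of a cube. -/
def toSet (Q : Cube n) : Set (Fin n → ℝ) := Metric.closedBall Q.center Q.half

/-- The sidelength ℓ(Q). -/
def side (Q : Cube n) : ℝ := 2 * Q.half

/-- The mean f_Q of f over Q. -/
def avg (Q : Cube n) (f : (Fin n → ℝ) → ℝ) : ℝ := ⨍ x in Q.toSet, f x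

/-- Mean oscillation of f over Q. -/
def osc (Q : Cube n) (f : (Fin n → ℝ) → ℝ) : ℝ := ⨍ x in Q.toSet, |f x - Q.avg f|

/-- The mean |f|_Q of |f| over Q. -/
def avgAbs (Q : Cube n) (f : (Fin n → ℝ) → ℝ) : ℝ := ⨍ x in Q.toSet, |f x|

/-- Distance from the cube to the origin. -/
def distToOrigin (Q : Cube n) : ℝ := Metric.infDist (0 : Fin n → ℝ) Q.toSet

/-- The cube 2Q, concentric with Q and of twice the sidelength. -/
def double (Q : Cube n) : Cube n := ⟨Q.center, 2 * Q.half, mul_pos two_pos Q.half_pos⟩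

end Cube

variable {n : ℕ}

/-- The modulus of mean oscillation ω_U(f,t): the supremum of the mean oscillation
of f over cubes Q ⊆ U of sidelength < t. -/
def omegaOn (U : Set (Fin n → ℝ)) (f : (Fin n → ℝ) → ℝ) (t : ℝ) : ℝ :=
  sSup {r | ∃ Q : Cube n, Q.toSet ⊆ U ∧ Q.side < t ∧ r = Q.osc f}

/-- sup{ |f|_Q : Q ⊆ U, ℓ(Q) ≥ lam }. -/
def bigAvgSup (U : Set (Fin n → ℝ)) (lam : ℝ) (f : (Fin n → ℝ) → ℝ) : ℝ :=
  sSup {r | ∃ Q : Cube n, Q.toSet ⊆ U ∧ lam ≤ Q.side ∧ r = Q.avgAbs f}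

/-- The nonhomogeneous norm ‖f‖_{bmo_lam(U)}. -/
def bmoNorm (U : Set (Fin n → ℝ)) (lam : ℝ) (f : (Fin n → ℝ) → ℝ) : ℝ :=
  omegaOn U f lam + bigAvgSup U lam f

/-- Membership in bmo_lam(U): integrable on every cube in U and finite norm. -/
def MemBmo (U : Set (Fin n → ℝ)) (lam : ℝ) (f : (Fin n → ℝ) → ℝ) : Prop :=
  (∀ Q : Cube n, Q.toSet ⊆ U → IntegrableOn f Q.toSet) ∧
  BddAbove {r | ∃ Q : Cube n, Q.toSet ⊆ U ∧ Q.side < lam ∧ r = Q.osc f} ∧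
  BddAbove {r | ∃ Q : Cube n, Q.toSet ⊆ U ∧ lam ≤ Q.side ∧ r = Q.avgAbs f}

/-- Sarason's vanishing mean oscillation condition: ω_U(f,t) → 0 as t → 0⁺. -/
def VanishSmallOsc (U : Set (Fin n → ℝ)) (f : (Fin n → ℝ) → ℝ) : Prop :=
  Tendsto (fun t => omegaOn U f t) (nhdsWithin 0 (Set.Ioi 0)) (nhds 0)

/-- f is bounded on U. -/
def BoundedOn (U : Set (Fin n → ℝ)) (f : (Fin n → ℝ) → ℝ) : Prop :=
  ∃ M : ℝ, ∀ x ∈ U, |f x| ≤ M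

/-- f is Lipschitz on U. -/
def LipschitzOn (U : Set (Fin n → ℝ)) (f : (Fin n → ℝ) → ℝ) : Prop :=
  ∃ K : NNReal, LipschitzOnWith K f U

/-- dist(supp f, ∂U) > 0. -/
def SuppAway (U : Set (Fin n → ℝ)) (f : (Fin n → ℝ) → ℝ) : Prop :=
  ∃ d > 0, ∀ x ∈ Function.support f, ∀ y ∈ frontier U, d ≤ dist x y

/-- The nonhomogeneous Lipschitz norm ‖f‖_{Lip_b(U)} = ‖f‖_∞ + Lipschitz seminorm. -/
def lipbNorm (U : Set (Fin n → ℝ)) (f : (Fin n → ℝ) → ℝ) : ℝ :=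
  sSup {r | ∃ x ∈ U, r = |f x|} +
  sSup {r | ∃ x ∈ U, ∃ y ∈ U, x ≠ y ∧ r = |f x - f y| / dist x y}

/-- U is a domain: a nonempty open connected subset of ℝⁿ. -/
def IsRealDomain (U : Set (Fin n → ℝ)) : Prop := IsOpen U ∧ IsConnected U

/-- U is an (ε,δ)-domain. -/
def IsEpsDeltaDomain (U : Set (Fin n → ℝ)) (ε δ : ℝ) : Prop :=
  ∀ x ∈ U, ∀ y ∈ U, dist x y < δ →
    ∃ γ : ℝ → (Fin n → ℝ), ContinuousOn γ (Set.Icc 0 1) ∧ γ 0 = x ∧ γ 1 = y ∧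
      (∀ t ∈ Set.Icc (0:ℝ) 1, γ t ∈ U) ∧
      eVariationOn γ (Set.Icc 0 1) ≤ ENNReal.ofReal (ε⁻¹ * dist x y) ∧
      ∀ t ∈ Set.Icc (0:ℝ) 1,
        ε * (dist (γ t) x * dist (γ t) y) / dist x y ≤ Metric.infDist (γ t) (frontier U)

/-- The natural scale λ_{ε,δ} for an (ε,δ)-domain. -/
def lamED (n : ℕ) (ε δ : ℝ) : ℝ := ε ^ 2 * δ / (320 * n * (1 + Real.sqrt n * ε))

/-- d_Ω(x) = dist(x,∂Ω). -/
def distBd (U : Set (Fin n → ℝ)) (x : Fin n → ℝ) : ℝ := Metric.infDist x (frontier U)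

/-- Ω̊_t = {x ∈ Ω : d_Ω(x) ≥ t}. -/
def innerPart (U : Set (Fin n → ℝ)) (t : ℝ) : Set (Fin n → ℝ) :=
  {x ∈ U | t ≤ distBd U x}

/-- f vanishes at infinity in the bmo_lam(U) sense. -/
def VanishAtInfinity (U : Set (Fin n → ℝ)) (lam : ℝ) (f : (Fin n → ℝ) → ℝ) : Prop :=
  Tendsto (fun R => bmoNorm (U \ Metric.closedBall 0 R) lam f) atTop (nhds 0)

/-- f vanishes at the boundary in the bmo_lam(U) sense. -/
def VanishAtBoundary (U : Set (Fin n → ℝ)) (lam : ℝ) (f : (Fin n → ℝ) → ℝ) : Prop :=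
  Tendsto (fun t => bmoNorm (U \ innerPart U t) lam f) (nhdsWithin 0 (Set.Ioi 0)) (nhds 0)

/-- f is in the bmo_lam(U)-closure of the continuous functions with compact support in U. -/
def InCmoClosure (U : Set (Fin n → ℝ)) (lam : ℝ) (f : (Fin n → ℝ) → ℝ) : Prop :=
  ∃ g : ℕ → (Fin n → ℝ) → ℝ,
    (∀ j, Continuous (g j) ∧ HasCompactSupport (g j) ∧ tsupport (g j) ⊆ U) ∧
    Tendsto (fun j => bmoNorm U lam (f - g j)) atTop (nhds 0)

/-- The homogeneous BMO(ℝⁿ) seminorm: sup of mean oscillation over all cubes. -/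
def bmoHNorm (f : (Fin n → ℝ) → ℝ) : ℝ := sSup {r | ∃ Q : Cube n, r = Q.osc f}

theorem volume_real_closedBall_pi (c : Fin n → ℝ) {r : ℝ} (hr : 0 ≤ r) :
    volume.real (closedBall c r) = (2 * r) ^ n := by
  rw [measureReal_def, Real.volume_pi_closedBall c hr, ENNReal.toReal_ofReal (by positivity),
    Fintype.card_fin]

/-- If `A` contains a concentric subcube of a cube, then it misses only a small part of the
cube. -/
theorem volume_real_closedBall_sdiff_le {c : Fin n → ℝ} {r θ : ℝ} (hr : 0 < r) (hθ : 0 ≤ θ)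
    (hθ1 : θ ≤ 1) {A : Set (Fin n → ℝ)} (hA : closedBall c (r * (1 - θ)) ⊆ A) :
    volume.real (closedBall c r \ A) ≤ n * θ * (2 * r) ^ n := by
  have h1 : volume.real (closedBall c r \ A) ≤
      volume.real (closedBall c r \ closedBall c (r * (1 - θ))) :=
    measureReal_mono (Set.sdiff_subset_sdiff_right hA)
      ((measure_mono Set.sdiff_subset).trans_lt measure_closedBall_lt_top).ne
  refine h1.trans ?_
  rw [measureReal_sdiff (closedBall_subset_closedBall (by nlinarith)) measurableSet_closedBall
      measure_closedBall_lt_top.ne,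
    volume_real_closedBall_pi _ hr.le,
    volume_real_closedBall_pi _ (mul_nonneg hr.le (by linarith)), ← mul_assoc, mul_pow _ (1 - θ)]
  have h2 := one_add_mul_le_pow (a := -θ) (by linarith) n
  have h3 : (0 : ℝ) < (2 * r) ^ n := by positivity
  rw [← sub_eq_add_neg] at h2
  nlinarith

/-- A cube is covered by finitely many non-overlapping cubes of comparable prescribed size. -/
theorem setIntegral_closedBall_le_of_tiles {F : (Fin n → ℝ) → ℝ} {c : Fin n → ℝ} {H a κ : ℝ}
    (ha : 0 < a) (haH : a ≤ H) (hF0 : ∀ x, 0 ≤ F x) (hF : IntegrableOn F (closedBall c H))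
    (hκ : ∀ y r, a / 2 < r → r ≤ a → closedBall y r ⊆ closedBall c H →
      ∫ x in closedBall y r, F x ≤ κ * (2 * r) ^ n) :
    ∫ x in closedBall c H, F x ≤ κ * (2 * H) ^ n := by
  have hH : 0 < H := ha.trans_le haH
  set m : ℕ := ⌈H / a⌉₊
  have hm1 : H / a ≤ m := Nat.le_ceil _
  have hm2 : (m : ℝ) < H / a + 1 := Nat.ceil_lt_add_one (by positivity)
  have h1 : 1 ≤ H / a := (one_le_div ha).2 haH
  have hm0 : (0 : ℝ) < m := by linarith
  have hmpos : 0 < m := by exact_mod_cast hm0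
  set r : ℝ := H / m with hr
  have hr0 : 0 < r := by positivity
  have hrm : r * m = H := by rw [hr]; field_simp
  have hra : r ≤ a := by
    rw [hr, div_le_iff₀ hm0]; rw [div_le_iff₀ ha] at hm1; linarith
  have har : a / 2 < r := by
    rw [hr, lt_div_iff₀ hm0]
    have : (m : ℝ) * a < (H / a + 1) * a := by gcongr
    rw [add_mul, div_mul_cancel₀ _ ha.ne'] at this
    linarith
  let y : (Fin n → Fin m) → (Fin n → ℝ) := fun j i => c i - H + (2 * (j i : ℕ) + 1) * r
  have hsub : ∀ j, closedBall (y j) r ⊆ closedBall c H := by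
    intro j
    refine closedBall_subset_closedBall' ?_
    rw [← le_sub_iff_add_le', dist_pi_le_iff (by nlinarith [(show (1:ℝ) ≤ m by exact_mod_cast hmpos)])]
    intro i
    have hj : ((j i : ℕ) : ℝ) + 1 ≤ m := by exact_mod_cast (j i).2
    have hj0 : (0 : ℝ) ≤ ((j i : ℕ) : ℝ) := Nat.cast_nonneg _
    rw [Real.dist_eq, abs_le]
    constructor <;> simp only [y] <;> nlinarith
  have hcov : closedBall c H ⊆ ⋃ j, closedBall (y j) r := by
    intro x hx
    rw [Set.mem_iUnion]
    have hxi : ∀ i, |x i - c i| ≤ H := fun i => by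
      rw [← Real.dist_eq]; exact (dist_le_pi_dist x c i).trans hx
    have : ∀ i, ∃ k : Fin m, |x i - (c i - H + (2 * (k : ℕ) + 1) * r)| ≤ r := by
      intro i
      obtain ⟨hl, hu⟩ := abs_le.1 (hxi i)
      set u : ℝ := (x i - (c i - H)) / (2 * r) with hu'
      have hu0 : 0 ≤ u := div_nonneg (by linarith) (by positivity)
      have hux : u * (2 * r) = x i - (c i - H) := by rw [hu']; field_simp
      by_cases hlt : ⌊u⌋₊ < m
      · refine ⟨⟨⌊u⌋₊, hlt⟩, ?_⟩
        have ha1 := Nat.floor_le hu0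
        have ha2 := Nat.lt_floor_add_one u
        rw [abs_le]
        constructor <;> simp only <;> nlinarith
      · refine ⟨⟨m - 1, by omega⟩, ?_⟩
        have ha1 := Nat.floor_le hu0
        have ha3 : (m : ℝ) ≤ u := le_trans (by exact_mod_cast not_lt.1 hlt) ha1
        have ha4 : ((m - 1 : ℕ) : ℝ) = m - 1 := by
          rw [Nat.cast_sub (by omega)]; simp
        rw [abs_le]
        simp only [ha4]
        constructor <;> nlinarith
    choose k hk using this
    refine ⟨k, ?_⟩
    rw [mem_closedBall, dist_pi_le_iff hr0.le]
    exact fun i => by rw [Real.dist_eq]; exact hk i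
  have hle : volume.restrict (closedBall c H) ≤
      ∑ j, volume.restrict (closedBall (y j) r) := by
    rw [← Measure.sum_fintype]
    exact (Measure.restrict_mono hcov le_rfl).trans Measure.restrict_iUnion_le
  calc ∫ x in closedBall c H, F x
      ≤ ∫ x, F x ∂(∑ j, volume.restrict (closedBall (y j) r)) :=
        integral_mono_measure hle (Eventually.of_forall hF0)
          (integrable_finsetSum_measure.2 fun j _ => hF.mono_set (hsub j))
    _ = ∑ j, ∫ x in closedBall (y j) r, F x :=
        integral_finsetSum_measure fun j _ => hF.mono_set (hsub j)
    _ ≤ ∑ _j : Fin n → Fin m, κ * (2 * r) ^ n :=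
        Finset.sum_le_sum fun j _ => hκ _ _ har hra (hsub j)
    _ = κ * (2 * H) ^ n := by
        rw [Finset.sum_const, Finset.card_univ, Fintype.card_fun, Fintype.card_fin,
          Fintype.card_fin, nsmul_eq_mul, ← hrm]
        push_cast
        rw [mul_left_comm, ← mul_assoc, ← mul_assoc, mul_assoc κ, ← mul_pow]
        ring

theorem Cube.volume_real_toSet (Q : Cube n) : volume.real Q.toSet = (2 * Q.half) ^ n :=
  volume_real_closedBall_pi _ Q.half_pos.le

theorem Cube.volume_real_toSet_pos (Q : Cube n) : 0 < volume.real Q.toSet := by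
  have := Q.half_pos
  rw [Q.volume_real_toSet]
  positivity

theorem Cube.measurableSet_toSet (Q : Cube n) : MeasurableSet Q.toSet :=
  measurableSet_closedBall

theorem Cube.volume_toSet_ne_top (Q : Cube n) : volume Q.toSet ≠ ⊤ :=
  measure_closedBall_lt_top.ne

theorem Cube.integrableOn_const (Q : Cube n) (c : ℝ) : IntegrableOn (fun _ => c) Q.toSet :=
  MeasureTheory.integrableOn_const Q.volume_toSet_ne_top

theorem Cube.integrableOn_abs_sub_const {Q : Cube n} {f : (Fin n → ℝ) → ℝ}
    (hf : IntegrableOn f Q.toSet) (c : ℝ) : IntegrableOn (fun x => |f x - c|) Q.toSet :=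
  (hf.sub (Q.integrableOn_const c)).abs

theorem Cube.osc_mul_volume (Q : Cube n) (f : (Fin n → ℝ) → ℝ) :
    ∫ x in Q.toSet, |f x - Q.avg f| = Q.osc f * volume.real Q.toSet := by
  have := Q.volume_real_toSet_pos.ne'
  rw [Cube.osc, setAverage_eq, smul_eq_mul]
  field_simp

theorem Cube.avgAbs_mul_volume (Q : Cube n) (f : (Fin n → ℝ) → ℝ) :
    ∫ x in Q.toSet, |f x| = Q.avgAbs f * volume.real Q.toSet := by
  have := Q.volume_real_toSet_pos.ne'
  rw [Cube.avgAbs, setAverage_eq, smul_eq_mul]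
  field_simp

theorem Cube.avg_mul_volume (Q : Cube n) (f : (Fin n → ℝ) → ℝ) :
    ∫ x in Q.toSet, f x = Q.avg f * volume.real Q.toSet := by
  have := Q.volume_real_toSet_pos.ne'
  rw [Cube.avg, setAverage_eq, smul_eq_mul]
  field_simp

theorem Cube.osc_nonneg (Q : Cube n) (f : (Fin n → ℝ) → ℝ) : 0 ≤ Q.osc f := by
  rw [Cube.osc, setAverage_eq]
  exact smul_nonneg (by positivity) (integral_nonneg fun _ => abs_nonneg _)

theorem Cube.avgAbs_nonneg (Q : Cube n) (f : (Fin n → ℝ) → ℝ) : 0 ≤ Q.avgAbs f := by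
  rw [Cube.avgAbs, setAverage_eq]
  exact smul_nonneg (by positivity) (integral_nonneg fun _ => abs_nonneg _)

theorem Cube.avgAbs_le {Q : Cube n} {f : (Fin n → ℝ) → ℝ} {κ : ℝ}
    (h : ∫ x in Q.toSet, |f x| ≤ κ * volume.real Q.toSet) : Q.avgAbs f ≤ κ := by
  rw [Q.avgAbs_mul_volume] at h
  exact le_of_mul_le_mul_right h Q.volume_real_toSet_pos

theorem Cube.abs_avg_le (Q : Cube n) (f : (Fin n → ℝ) → ℝ) : |Q.avg f| ≤ Q.avgAbs f := by
  have h := abs_integral_le_integral_abs (μ := volume.restrict Q.toSet) (f := f)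
  rw [Q.avgAbs_mul_volume, Q.avg_mul_volume, abs_mul, abs_of_pos Q.volume_real_toSet_pos] at h
  exact le_of_mul_le_mul_right h Q.volume_real_toSet_pos

theorem Cube.avg_sub_const {Q : Cube n} {f : (Fin n → ℝ) → ℝ} (hf : IntegrableOn f Q.toSet)
    (c : ℝ) : Q.avg (fun x => f x - c) = Q.avg f - c := by
  have h := Q.avg_mul_volume (fun x => f x - c)
  rw [integral_sub hf (Q.integrableOn_const c), Q.avg_mul_volume, setIntegral_const,
    smul_eq_mul, mul_comm _ c, ← sub_mul] at h
  exact (mul_right_cancel₀ Q.volume_real_toSet_pos.ne' h).symm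

/-- The mean oscillation is at most twice the mean distance to any constant. -/
theorem Cube.osc_le {Q : Cube n} {f : (Fin n → ℝ) → ℝ} (hf : IntegrableOn f Q.toSet) {c κ : ℝ}
    (h : ∫ x in Q.toSet, |f x - c| ≤ κ * volume.real Q.toSet) : Q.osc f ≤ 2 * κ := by
  have hV := Q.volume_real_toSet_pos
  have h1 : |Q.avg f - c| ≤ κ := by
    rw [← Cube.avg_sub_const hf]
    exact (Q.abs_avg_le _).trans (Cube.avgAbs_le h)
  have h2 : ∫ x in Q.toSet, |f x - Q.avg f| ≤ ∫ x in Q.toSet, (|f x - c| + κ) := by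
    refine integral_mono (Cube.integrableOn_abs_sub_const hf _)
      ((Cube.integrableOn_abs_sub_const hf _).add (Q.integrableOn_const κ)) fun x => ?_
    have := abs_sub_le (f x) c (Q.avg f)
    rw [abs_sub_comm c] at this
    simp only
    linarith
  rw [integral_add (Cube.integrableOn_abs_sub_const hf _) (Q.integrableOn_const κ),
    setIntegral_const, smul_eq_mul, Q.osc_mul_volume] at h2
  refine le_of_mul_le_mul_right ?_ hV
  linarith

theorem Cube.osc_le_two_mul_avgAbs {Q : Cube n} {f : (Fin n → ℝ) → ℝ}
    (hf : IntegrableOn f Q.toSet) : Q.osc f ≤ 2 * Q.avgAbs f := by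
  refine Cube.osc_le hf (c := 0) ?_
  simp only [sub_zero]
  exact (Q.avgAbs_mul_volume f).le

/-- Mean distances to constants are subadditive under a pointwise triangle inequality. -/
theorem Cube.setIntegral_abs_le_add {Q : Cube n} {u v w : (Fin n → ℝ) → ℝ}
    (hv : IntegrableOn v Q.toSet) (hw : IntegrableOn w Q.toSet) {a b : ℝ}
    (huvw : ∀ x ∈ Q.toSet, |u x| ≤ |v x| + |w x|)
    (ha : ∫ x in Q.toSet, |v x| ≤ a * volume.real Q.toSet)
    (hb : ∫ x in Q.toSet, |w x| ≤ b * volume.real Q.toSet) :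
    ∫ x in Q.toSet, |u x| ≤ (a + b) * volume.real Q.toSet := by
  have h : ∫ x in Q.toSet, |u x| ≤ ∫ x in Q.toSet, (|v x| + |w x|) :=
    integral_mono_of_nonneg (Eventually.of_forall fun _ => abs_nonneg _) (hv.abs.add hw.abs)
      ((ae_restrict_mem Q.measurableSet_toSet).mono huvw)
  rw [integral_add hv.abs hw.abs] at h
  linarith

/-- A distance to the complement of an open set, capped at height `s`. -/
theorem exists_cappedDist {U : Set (Fin n → ℝ)} (hU : IsOpen U) {s : ℝ} (hs : 0 < s) :
    ∃ ρ : (Fin n → ℝ) → ℝ, LipschitzWith 1 ρ ∧ (∀ x, ρ x ≤ s) ∧ (∀ x ∈ U, 0 < ρ x) ∧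
      (∀ x, x ∉ U → ρ x = 0) ∧ ∀ x r, r ≤ s → closedBall x r ⊆ U → r ≤ ρ x := by
  rcases Set.eq_empty_or_nonempty Uᶜ with h | h
  · refine ⟨fun _ => s, LipschitzWith.const' s, fun _ => le_rfl, fun _ _ => hs, fun x hx => ?_,
      fun _ _ hr _ => hr⟩
    exact absurd (show x ∈ Uᶜ from hx) (by simp [h])
  · refine ⟨fun x => min s (infDist x Uᶜ), (lipschitz_infDist_pt _).const_min s,
      fun _ => min_le_left _ _, fun x hx => lt_min hs ?_, fun x hx => ?_, fun x r hr hsub =>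
      le_min hr ?_⟩
    · exact (hU.isClosed_compl.notMem_iff_infDist_pos h).1 (by simpa using hx)
    · simp only [infDist_zero_of_mem (show x ∈ Uᶜ from hx), min_eq_right hs.le]
    · refine (le_infDist h).2 fun y hy => le_of_not_gt fun hlt => hy (hsub ?_)
      rw [mem_closedBall, dist_comm]
      exact hlt.le

theorem abs_max_zero_log_div_sub_le {a p δ t : ℝ} (ha : 0 < a) (hp : 0 < p) (hδ : 0 < δ)
    (h1 : a ≤ p * Real.exp t) (h2 : p * Real.exp (-t) ≤ a) :
    |max 0 (Real.log (a / δ)) - max 0 (Real.log (p / δ))| ≤ t := by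
  refine (abs_max_sub_max_le_max 0 _ 0 _).trans ?_
  rw [sub_self, abs_zero, Real.log_div ha.ne' hδ.ne', Real.log_div hp.ne' hδ.ne',
    sub_sub_sub_cancel_right]
  have e1 := Real.log_le_log ha h1
  have e2 := Real.log_le_log (by positivity) h2
  rw [Real.log_mul hp.ne' (Real.exp_ne_zero _), Real.log_exp] at e1 e2
  have e3 : |Real.log a - Real.log p| ≤ t := abs_le.2 ⟨by linarith, by linarith⟩
  exact max_le ((abs_nonneg _).trans e3) e3

/-- A function on a cube whose distribution has exponential tails has bounded mean. -/
theorem setIntegral_le_of_exp_tail (hn : 0 < n) {c : Fin n → ℝ} {r : ℝ} (hr : 0 < r)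
    {D : (Fin n → ℝ) → ℝ} (hD0 : ∀ x, 0 ≤ D x) (hDm : Measurable D)
    (hD : IntegrableOn D (closedBall c r))
    (htail : ∀ t, Real.log 2 ≤ t → ∀ x ∈ closedBall c (r * (1 - Real.exp (-t))), D x ≤ t) :
    ∫ x in closedBall c r, D x ≤ 2 * n * (2 * r) ^ n := by
  have hV : (0 : ℝ) < (2 * r) ^ n := by positivity
  have hn1 : (1 : ℝ) ≤ n := by exact_mod_cast hn
  rw [hD.integral_eq_integral_meas_lt (Eventually.of_forall hD0)]
  have hb : ∀ t, 0 < t → (volume.restrict (closedBall c r)).real {x | t < D x} ≤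
      2 * n * (2 * r) ^ n * Real.exp (-t) := by
    intro t ht
    rw [measureReal_restrict_apply (measurableSet_lt measurable_const hDm), Set.inter_comm]
    rcases le_or_gt (Real.log 2) t with h | h
    · have h1 := volume_real_closedBall_sdiff_le (c := c) hr (Real.exp_pos (-t)).le
        (Real.exp_le_one_iff.2 (by linarith)) (A := {x | D x ≤ t}) (htail t h)
      have h2 : closedBall c r ∩ {x | t < D x} = closedBall c r \ {x | D x ≤ t} := by
        ext x; simp
      rw [h2]
      refine h1.trans ?_
      have : 0 ≤ (n : ℝ) * Real.exp (-t) * (2 * r) ^ n := by positivity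
      linarith
    · have h1 : volume.real (closedBall c r ∩ {x | t < D x}) ≤ (2 * r) ^ n := by
        rw [← volume_real_closedBall_pi c hr.le]
        exact measureReal_mono Set.inter_subset_left measure_closedBall_lt_top.ne
      have h2 : (1 : ℝ) ≤ 2 * Real.exp (-t) := by
        have := Real.exp_le_exp.2 (neg_le_neg h.le)
        rw [Real.exp_neg, Real.exp_log two_pos] at this
        linarith
      refine h1.trans ?_
      calc (2 * r) ^ n = 1 * 1 * (2 * r) ^ n := by ring
        _ ≤ n * (2 * Real.exp (-t)) * (2 * r) ^ n := by gcongr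
        _ = _ := by ring
  have hint : IntegrableOn (fun t => 2 * n * (2 * r) ^ n * Real.exp (-t)) (Set.Ioi (0 : ℝ)) :=
    (integrableOn_exp_neg_Ioi 0).const_mul _
  refine (integral_mono_of_nonneg (Eventually.of_forall fun _ => measureReal_nonneg) hint
    ((ae_restrict_mem measurableSet_Ioi).mono hb)).trans ?_
  rw [integral_const_mul, integral_exp_neg_Ioi_zero, mul_one]

/-- A bounded function of small mean oscillation which is large well inside `U` and vanishes
near the boundary of `U`: a truncated logarithm of the distance to the boundary. -/
theorem exists_logCutoff (hn : 0 < n) {U : Set (Fin n → ℝ)} (hU : IsOpen U) {s ε : ℝ}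
    (hs : 0 < s) (hε : 0 < ε) {σ : ℝ} (hσ : 0 < σ) (hσs : σ ≤ s) (M : ℝ) :
    ∃ L : (Fin n → ℝ) → ℝ, ∃ δ > 0, Measurable L ∧ (∀ x, 0 ≤ L x) ∧ (∃ B, ∀ x, L x ≤ B) ∧
      (∀ x, L x ≠ 0 → ∀ y, y ∉ U → δ ≤ dist x y) ∧
      (∀ x, closedBall x σ ⊆ U → M ≤ L x) ∧
      ∀ Q : Cube n, Q.half ≤ s → Q.toSet ⊆ U →
        ∃ l, 0 ≤ l ∧ ∫ x in Q.toSet, |L x - l| ≤ 2 * n * ε * volume.real Q.toSet := by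
  obtain ⟨ρ, hρl, hρs, hρ0, hρz, hρb⟩ := exists_cappedDist hU hs
  have hρd : ∀ x y, |ρ x - ρ y| ≤ dist x y := fun x y => by
    simpa [Real.dist_eq] using hρl.dist_le_mul x y
  set δ : ℝ := σ * Real.exp (-(M / ε)) with hδ
  have hδ0 : 0 < δ := by positivity
  have hsδ : Real.log (σ / δ) = M / ε := by
    rw [hδ, div_mul_cancel_left₀ hσ.ne', Real.log_inv, Real.log_exp, neg_neg]
  set L₀ : (Fin n → ℝ) → ℝ := fun x => max 0 (Real.log (ρ x / δ)) with hL₀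
  have hρn : ∀ x, 0 ≤ ρ x := fun x => by
    by_cases hx : x ∈ U
    · exact (hρ0 x hx).le
    · exact (hρz x hx).ge
  have hL₀m : Measurable L₀ :=
    measurable_const.max (Real.measurable_log.comp (hρl.continuous.measurable.div_const δ))
  have hL₀0 : ∀ x, 0 ≤ L₀ x := fun x => le_max_left _ _
  have hL₀b : ∀ x, L₀ x ≤ max 0 (Real.log (s / δ)) := by
    intro x
    rcases (hρn x).eq_or_lt with h | h
    · simp [hL₀, ← h]
    · refine max_le_max le_rfl (Real.log_le_log (by positivity) ?_)
      have := hρs x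
      gcongr
  refine ⟨fun x => ε * L₀ x, δ, hδ0, hL₀m.const_mul ε, fun x => mul_nonneg hε.le (hL₀0 x),
    ⟨ε * max 0 (Real.log (s / δ)), fun x =>
      mul_le_mul_of_nonneg_left (hL₀b x) hε.le⟩, fun x hx y hy => ?_,
    fun x hx => ?_, fun Q hQs hQU => ?_⟩
  · by_contra hlt
    apply hx
    have h1 : ρ x ≤ δ := by
      have := hρd x y
      rw [hρz y hy, sub_zero, abs_of_nonneg (hρn x)] at this
      linarith
    have h2 : Real.log (ρ x / δ) ≤ 0 :=
      Real.log_nonpos (div_nonneg (hρn x) hδ0.le) ((div_le_one hδ0).2 h1)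
    simp [hL₀, max_eq_left h2]
  · have h1 : σ ≤ ρ x := hρb x _ hσs hx
    have h2 : M / ε ≤ L₀ x := by
      rw [← hsδ]
      refine le_max_of_le_right (Real.log_le_log (by positivity) (by gcongr))
    rw [div_le_iff₀ hε] at h2
    linarith
  · obtain ⟨c, r, hr⟩ := Q
    simp only [Cube.toSet] at *
    have hP : r ≤ ρ c := hρb c r hQs hQU
    have hP0 : 0 < ρ c := hr.trans_le hP
    refine ⟨ε * max 0 (Real.log (ρ c / δ)), by positivity, ?_⟩
    have hmain := setIntegral_le_of_exp_tail hn (c := c) hr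
      (D := fun x => |L₀ x - max 0 (Real.log (ρ c / δ))|) (fun x => abs_nonneg _)
      (hL₀m.sub_const _).abs ?_ ?_
    · simp only [← mul_sub, abs_mul, abs_of_pos hε]
      rw [integral_const_mul, volume_real_closedBall_pi c hr.le]
      calc _ ≤ ε * (2 * n * (2 * r) ^ n) := by gcongr
        _ = _ := by ring
    · refine Measure.integrableOn_of_bounded (M := max 0 (Real.log (s / δ)))
        measure_closedBall_lt_top.ne (hL₀m.sub_const _).abs.aestronglyMeasurable
        (Eventually.of_forall fun x => ?_)
      have h1 := hL₀b x
      have h2 := hL₀b c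
      have h3 := hL₀0 x
      have h4 := hL₀0 c
      simp only [hL₀] at h1 h2 h3 h4 ⊢
      rw [Real.norm_eq_abs, abs_abs, abs_le]
      constructor <;> linarith
    · intro t ht x hx
      have hexp : 2 ≤ Real.exp t := by
        rw [← Real.exp_log two_pos]; exact Real.exp_le_exp.2 ht
      have hxd : |ρ x - ρ c| ≤ ρ c * (1 - Real.exp (-t)) := by
        refine (hρd x c).trans ((mem_closedBall.1 hx).trans ?_)
        have : 0 ≤ 1 - Real.exp (-t) :=
          sub_nonneg.2 (Real.exp_le_one_iff.2 (by linarith [Real.log_pos one_lt_two]))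
        gcongr
      obtain ⟨ha, hb⟩ := abs_le.1 hxd
      have hem : 0 < Real.exp (-t) := Real.exp_pos _
      refine abs_max_zero_log_div_sub_le (by nlinarith) hP0 hδ0 (by nlinarith) (by nlinarith)

theorem abs_clamp_sub_clamp_le (x y a b : ℝ) :
    |max (-a) (min x a) - max (-b) (min y b)| ≤ |x - y| + |a - b| := by
  refine (abs_max_sub_max_le_max _ _ _ _).trans (max_le ?_ ?_)
  · rw [neg_sub_neg, abs_sub_comm]
    linarith [abs_nonneg (x - y)]
  · refine (abs_min_sub_min_le_max _ _ _ _).trans (max_le ?_ ?_)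
    · linarith [abs_nonneg (a - b)]
    · linarith [abs_nonneg (x - y)]

theorem abs_sub_clamp_le {x a c : ℝ} (hc : |c| ≤ a) :
    |x - max (-a) (min x a)| ≤ |x - c| := by
  obtain ⟨h1, h2⟩ := abs_le.1 hc
  rcases le_total x a with h | h
  · rw [min_eq_left h]
    rcases le_total (-a) x with h' | h'
    · rw [max_eq_right h', sub_self, abs_zero]
      exact abs_nonneg _
    · rw [max_eq_left h', abs_of_nonpos (by linarith), abs_of_nonpos (by linarith)]
      linarith
  · rw [min_eq_right h, max_eq_right (by linarith), abs_of_nonneg (by linarith),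
      abs_of_nonneg (by linarith)]
    linarith

theorem abs_clamp_le {x a : ℝ} (ha : 0 ≤ a) : |max (-a) (min x a)| ≤ a :=
  abs_le.2 ⟨le_max_left _ _, max_le (by linarith) (min_le_right _ _)⟩

theorem aestronglyMeasurable_restrict_of_integrableOn_cubes {U : Set (Fin n → ℝ)} (hU : IsOpen U)
    {f : (Fin n → ℝ) → ℝ} (hf : ∀ Q : Cube n, Q.toSet ⊆ U → IntegrableOn f Q.toSet) :
    AEStronglyMeasurable f (volume.restrict U) := by
  refine LocallyIntegrableOn.aestronglyMeasurable fun x hx => ?_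
  obtain ⟨r, hr, hrU⟩ := nhds_basis_closedBall.mem_iff.1 (hU.mem_nhds hx)
  exact ⟨closedBall x r, mem_nhdsWithin_of_mem_nhds (closedBall_mem_nhds x hr),
    hf ⟨x, r, hr⟩ hrU⟩

theorem Cube.integrableOn_of_bounded {F : (Fin n → ℝ) → ℝ} (hF : AEStronglyMeasurable F volume)
    {B : ℝ} (hB : ∀ x, |F x| ≤ B) (Q : Cube n) : IntegrableOn F Q.toSet :=
  Measure.integrableOn_of_bounded Q.volume_toSet_ne_top hF (Eventually.of_forall hB)

/-- If a function has small mean oscillation on a cube, and small mean on the concentric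
subcube of half the side, then it has small mean on the cube. -/
theorem Cube.setIntegral_abs_le_of_half {Q R : Cube n} (hc : R.center = Q.center)
    (hh : R.half = Q.half / 2) {w : (Fin n → ℝ) → ℝ} (hw : IntegrableOn w Q.toSet) {a b c : ℝ}
    (hQ : ∫ x in Q.toSet, |w x - c| ≤ a * volume.real Q.toSet)
    (hR : ∫ x in R.toSet, |w x| ≤ b * volume.real R.toSet) :
    ∫ x in Q.toSet, |w x| ≤ (a + (b + 2 ^ n * a)) * volume.real Q.toSet := by
  have hRQ : R.toSet ⊆ Q.toSet := by
    rw [Cube.toSet, Cube.toSet, hc, hh]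
    exact closedBall_subset_closedBall (by linarith [Q.half_pos])
  have hV : volume.real Q.toSet = 2 ^ n * volume.real R.toSet := by
    rw [Q.volume_real_toSet, R.volume_real_toSet, hh, ← mul_pow]
    congr 1
    ring
  have h1 : ∫ x in R.toSet, |w x - c| ≤ 2 ^ n * a * volume.real R.toSet := by
    refine (setIntegral_mono_set (Cube.integrableOn_abs_sub_const hw c)
      (Eventually.of_forall fun _ => abs_nonneg _) hRQ.eventuallyLE).trans (hQ.trans_eq ?_)
    rw [hV]
    ring
  have h2 : ∫ x in R.toSet, |c| ≤ (b + 2 ^ n * a) * volume.real R.toSet := by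
    refine Cube.setIntegral_abs_le_add (u := fun _ => c) (hw.mono_set hRQ)
      ((hw.mono_set hRQ).sub (R.integrableOn_const c)) (fun x _ => ?_) hR h1
    simpa using abs_sub (w x) (w x - c)
  have h3 : |c| ≤ b + 2 ^ n * a := by
    rw [setIntegral_const, smul_eq_mul, mul_comm] at h2
    exact le_of_mul_le_mul_right h2 R.volume_real_toSet_pos
  refine Cube.setIntegral_abs_le_add (v := fun x => w x - c) (w := fun _ => c)
    (hw.sub (Q.integrableOn_const c)) (Q.integrableOn_const c) (fun x _ => ?_) hQ ?_
  · simpa using abs_add_le (w x - c) c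
  · rw [setIntegral_const, smul_eq_mul, mul_comm]
    have := Q.volume_real_toSet_pos
    gcongr

/-- A function of small mean oscillation at scale `s`, whose means at scale `s` are bounded, is
close to a bounded function which vanishes near the boundary. -/
theorem exists_truncation (hn : 0 < n) {U : Set (Fin n → ℝ)} (hU : IsOpen U)
    {f : (Fin n → ℝ) → ℝ} (hf : ∀ Q : Cube n, Q.toSet ⊆ U → IntegrableOn f Q.toSet)
    {s ε M : ℝ} (hs : 0 < s) (hε : 0 < ε)
    (hosc : ∀ Q : Cube n, Q.toSet ⊆ U → Q.side < s → Q.osc f ≤ ε)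
    (havg : ∀ Q : Cube n, Q.toSet ⊆ U → s / 8 ≤ Q.side → Q.avgAbs f ≤ M) :
    ∃ F : (Fin n → ℝ) → ℝ, ∃ δ > 0, AEStronglyMeasurable F volume ∧
      (∃ B, ∀ x, |F x| ≤ B) ∧ (∀ x, F x ≠ 0 → ∀ y, y ∉ U → δ ≤ dist x y) ∧
      (∀ Q : Cube n, Q.toSet ⊆ U → Q.side < s → ∃ c,
        ∫ x in Q.toSet, |F x - c| ≤ (2 + 2 * n) * ε * volume.real Q.toSet) ∧
      (∀ Q : Cube n, Q.toSet ⊆ U → Q.side < s → ∃ c,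
        ∫ x in Q.toSet, |(f x - F x) - c| ≤ (2 + 2 * n) * ε * volume.real Q.toSet) ∧
      ∀ Q : Cube n, Q.toSet ⊆ U → s ≤ Q.side →
        ∫ x in Q.toSet, |f x - F x| ≤ (2 + 2 ^ n) * ((2 + 2 * n) * ε) * volume.real Q.toSet := by
  obtain ⟨L, δ, hδ, hLm, hL0, ⟨B, hLB⟩, hLδ, hLM, hLosc⟩ :=
    exists_logCutoff hn hU hs hε (σ := s / 16) (by positivity) (by linarith) M
  set F : (Fin n → ℝ) → ℝ := fun x => max (-L x) (min (f x) (L x)) with hF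
  have hFB : ∀ x, |F x| ≤ B := fun x => (abs_clamp_le (hL0 x)).trans (hLB x)
  have hFδ : ∀ x, F x ≠ 0 → ∀ y, y ∉ U → δ ≤ dist x y := fun x hx =>
    hLδ x fun h => hx (abs_nonpos_iff.1 (h ▸ abs_clamp_le (hL0 x)))
  have hFm : AEStronglyMeasurable F volume := by
    have h1 : AEStronglyMeasurable F (volume.restrict U) :=
      (hLm.neg.aestronglyMeasurable).sup
        ((aestronglyMeasurable_restrict_of_integrableOn_cubes hU hf).inf
          hLm.aestronglyMeasurable)
    rw [← aestronglyMeasurable_indicator_iff hU.measurableSet] at h1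
    rwa [Set.indicator_eq_self.2] at h1
    intro x hx
    by_contra hxU
    have := hFδ x hx x hxU
    rw [dist_self] at this
    linarith
  have hFi := Cube.integrableOn_of_bounded hFm hFB
  have hside : ∀ Q : Cube n, Q.side < s → Q.half ≤ s := fun Q hQ => by
    have := Q.half_pos
    simp only [Cube.side] at hQ
    linarith
  have hsmall : ∀ Q : Cube n, Q.toSet ⊆ U → Q.side < s → ∃ c,
      ∫ x in Q.toSet, |F x - c| ≤ (ε + 2 * n * ε) * volume.real Q.toSet := by
    intro Q hQU hQs
    obtain ⟨l, hl, hLl⟩ := hLosc Q (hside Q hQs) hQU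
    refine ⟨max (-l) (min (Q.avg f) l), ?_⟩
    refine Cube.setIntegral_abs_le_add ((hf Q hQU).sub (Q.integrableOn_const (Q.avg f)))
      (w := fun x => L x - l) ?_ (fun x _ => abs_clamp_sub_clamp_le _ _ _ _) ?_ hLl
    · exact (Cube.integrableOn_of_bounded hLm.aestronglyMeasurable (B := B) (fun x => by
        rw [abs_of_nonneg (hL0 x)]; exact hLB x) Q).sub (Q.integrableOn_const l)
    · have := hosc Q hQU hQs
      simp only [Pi.sub_apply]
      rw [Q.osc_mul_volume]
      gcongr
  have hdiff : ∀ Q : Cube n, Q.toSet ⊆ U → Q.side < s → ∃ c,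
      ∫ x in Q.toSet, |(f x - F x) - c| ≤ (2 + 2 * n) * ε * volume.real Q.toSet := by
    intro Q hQU hQs
    obtain ⟨c, hc⟩ := hsmall Q hQU hQs
    refine ⟨Q.avg f - c, ?_⟩
    have : (2 + 2 * (n : ℝ)) * ε = ε + (ε + 2 * n * ε) := by ring
    rw [this]
    refine Cube.setIntegral_abs_le_add ((hf Q hQU).sub (Q.integrableOn_const (Q.avg f)))
      ((hFi Q).sub (Q.integrableOn_const c)) (fun x _ => ?_) ?_ hc
    · have := abs_sub (f x - Q.avg f) (F x - c)
      rwa [show f x - Q.avg f - (F x - c) = f x - F x - (Q.avg f - c) by ring] at this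
    · have := hosc Q hQU hQs
      simp only [Pi.sub_apply]
      rw [Q.osc_mul_volume]
      gcongr
  refine ⟨F, δ, hδ, hFm, ⟨B, hFB⟩, hFδ, fun Q hQU hQs => ?_, hdiff, fun Q hQU hQs => ?_⟩
  · obtain ⟨c, hc⟩ := hsmall Q hQU hQs
    refine ⟨c, hc.trans ?_⟩
    gcongr
    linarith
  · have hQs' : s / 4 ≤ Q.half := by
      simp only [Cube.side] at hQs
      linarith
    have hw : ∀ R : Cube n, R.toSet ⊆ U → IntegrableOn (fun x => f x - F x) R.toSet :=
      fun R hR => (hf R hR).sub (hFi R)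
    rw [Q.volume_real_toSet]
    refine setIntegral_closedBall_le_of_tiles (by positivity) hQs' (fun _ => abs_nonneg _)
      (hw Q hQU).abs fun y r hr1 hr2 hyr => ?_
    have hr0 : 0 < r := by linarith
    let R : Cube n := ⟨y, r, hr0⟩
    let R' : Cube n := ⟨y, r / 2, by positivity⟩
    have hRU : R.toSet ⊆ U := hyr.trans hQU
    have hR'R : R'.toSet ⊆ R.toSet := closedBall_subset_closedBall (show r / 2 ≤ r by linarith)
    have hR'U : R'.toSet ⊆ U := hR'R.trans hRU
    obtain ⟨c, hc⟩ := hdiff R hRU (by simp only [Cube.side, R]; linarith)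
    have hcore : ∫ x in R'.toSet, |f x - F x| ≤ ε * volume.real R'.toSet := by
      have h1 : ∫ x in R'.toSet, |f x - F x| ≤ ∫ x in R'.toSet, |f x - R'.avg f| := by
        refine setIntegral_mono_on (hw R' hR'U).abs
          (Cube.integrableOn_abs_sub_const (hf R' hR'U) _) R'.measurableSet_toSet fun x hx => ?_
        refine abs_sub_clamp_le ((R'.abs_avg_le f).trans
          ((havg R' hR'U (by simp only [Cube.side, R']; linarith)).trans (hLM x ?_)))
        refine (closedBall_subset_closedBall' ?_).trans hRU
        have : dist x y ≤ r / 2 := hx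
        simp only [R]
        linarith
      rw [R'.osc_mul_volume] at h1
      have := hosc R' hR'U (by simp only [Cube.side, R']; linarith)
      refine h1.trans ?_
      gcongr
    have h2 := Cube.setIntegral_abs_le_of_half (Q := R) (R := R') rfl rfl (hw R hRU) hc hcore
    rw [R.volume_real_toSet] at h2
    refine h2.trans ?_
    simp only [R]
    have h3 : ε ≤ (2 + 2 * n) * ε := by nlinarith [(Nat.cast_nonneg n : (0 : ℝ) ≤ n)]
    calc _ ≤ ((2 + 2 * n) * ε + ((2 + 2 * n) * ε + 2 ^ n * ((2 + 2 * n) * ε))) * (2 * r) ^ n := by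
          gcongr
      _ = _ := by ring

theorem Cube.setIntegral_abs_le_of_forall {Q : Cube n} {u : (Fin n → ℝ) → ℝ} {b : ℝ}
    (h : ∀ x ∈ Q.toSet, |u x| ≤ b) : ∫ x in Q.toSet, |u x| ≤ b * volume.real Q.toSet := by
  refine (le_abs_self _).trans (norm_setIntegral_le_of_norm_le_const
    (f := fun x => |u x|) Q.volume_toSet_ne_top.lt_top fun x hx => ?_)
  rw [Real.norm_eq_abs, abs_abs]
  exact h x hx

/-- The moving average of `F` over cubes of half-side `r`. -/
def movingAvg {r : ℝ} (hr : 0 < r) (F : (Fin n → ℝ) → ℝ) (x : Fin n → ℝ) : ℝ :=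
  (⟨x, r, hr⟩ : Cube n).avg F

section movingAvg

variable {r : ℝ} (hr : 0 < r) {F : (Fin n → ℝ) → ℝ} {B : ℝ}

theorem abs_movingAvg_le (hB : ∀ x, |F x| ≤ B) (x : Fin n → ℝ) : |movingAvg hr F x| ≤ B := by
  refine (Cube.abs_avg_le _ _).trans (Cube.avgAbs_le ?_)
  exact Cube.setIntegral_abs_le_of_forall fun x _ => hB x

theorem exists_ne_zero_of_movingAvg_ne_zero {x : Fin n → ℝ} (h : movingAvg hr F x ≠ 0) :
    ∃ z ∈ closedBall x r, F z ≠ 0 := by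
  by_contra! hz
  have h1 := Cube.avg_mul_volume ⟨x, r, hr⟩ F
  rw [setIntegral_eq_zero_of_forall_eq_zero (t := Cube.toSet ⟨x, r, hr⟩) hz] at h1
  exact h ((mul_eq_zero.1 h1.symm).resolve_right (Cube.volume_real_toSet_pos _).ne')

theorem abs_movingAvg_sub_le (hn : 0 < n) (hF : AEStronglyMeasurable F volume)
    (hB : ∀ x, |F x| ≤ B) (x y : Fin n → ℝ) :
    |movingAvg hr F x - movingAvg hr F y| ≤ 2 * B * n / r * dist x y := by
  have hB0 : 0 ≤ B := (abs_nonneg _).trans (hB 0)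
  set θ : ℝ := dist x y / r with hθ
  have hθ0 : 0 ≤ θ := by positivity
  have hθr : r * θ = dist x y := by rw [hθ]; field_simp
  have hgoal : 2 * B * n / r * dist x y = 2 * (B * (n * θ)) := by rw [hθ]; ring
  rw [hgoal]
  rcases le_or_gt θ 1 with h | h
  · have hi : ∀ z, IntegrableOn F (closedBall z r) := fun z =>
      Cube.integrableOn_of_bounded hF hB ⟨z, r, hr⟩
    have hsub : ∀ z z' : Fin n → ℝ, dist z z' = dist x y →
        |∫ u in closedBall z r \ closedBall z' r, F u| ≤ B * (n * θ) * (2 * r) ^ n := by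
      intro z z' hzz
      have h1 := volume_real_closedBall_sdiff_le hr hθ0 h
        (closedBall_subset_closedBall' (x := z) (y := z') (ε₁ := r * (1 - θ)) (ε₂ := r)
          (by rw [hzz, ← hθr]; exact (by ring : r * (1 - θ) + r * θ = r).le))
      refine (norm_setIntegral_le_of_norm_le_const (C := B) (f := F)
        ((measure_mono Set.sdiff_subset).trans_lt measure_closedBall_lt_top)
        fun u _ => hB u).trans ?_
      rw [mul_assoc]
      gcongr
    have e1 := integral_inter_add_sdiff (measurableSet_closedBall (x := y) (ε := r)) (hi x)
    have e2 := integral_inter_add_sdiff (measurableSet_closedBall (x := x) (ε := r)) (hi y)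
    rw [Set.inter_comm] at e2
    have a1 := Cube.avg_mul_volume ⟨x, r, hr⟩ F
    have a2 := Cube.avg_mul_volume ⟨y, r, hr⟩ F
    rw [Cube.volume_real_toSet] at a1 a2
    simp only [Cube.toSet] at a1 a2
    have hV : (0 : ℝ) < (2 * r) ^ n := by positivity
    have b1 := abs_le.1 (hsub x y rfl)
    have b2 := abs_le.1 (hsub y x (dist_comm _ _))
    refine le_of_mul_le_mul_right ?_ hV
    rw [← abs_of_pos hV, ← abs_mul, abs_of_pos hV, sub_mul, movingAvg, movingAvg, ← a1, ← a2,
      abs_le]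
    constructor <;> linarith [b1.1, b1.2, b2.1, b2.2]
  · have h1 := abs_le.1 (abs_movingAvg_le hr hB x)
    have h2 := abs_le.1 (abs_movingAvg_le hr hB y)
    have hn1 : (1 : ℝ) ≤ n := by exact_mod_cast hn
    have h3 : B * (1 * 1) ≤ B * (n * θ) := by gcongr
    rw [abs_le]
    constructor <;> linarith [h1.1, h1.2, h2.1, h2.2]

theorem abs_movingAvg_sub_const_le {Q R : Cube n} (hQr : Q.half ≤ r) (hc : R.center = Q.center)
    (hh : R.half = 2 * r) (hF : IntegrableOn F R.toSet) {c κ : ℝ}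
    (h : ∫ x in R.toSet, |F x - c| ≤ κ * volume.real R.toSet) {x : Fin n → ℝ}
    (hx : x ∈ Q.toSet) : |movingAvg hr F x - c| ≤ 2 ^ n * κ := by
  let P : Cube n := ⟨x, r, hr⟩
  have hPR : P.toSet ⊆ R.toSet := by
    refine closedBall_subset_closedBall' ?_
    have h1 : dist x Q.center ≤ Q.half := hx
    rw [hc, hh]
    simp only [P]
    linarith
  have hV : volume.real R.toSet = 2 ^ n * volume.real P.toSet := by
    rw [R.volume_real_toSet, P.volume_real_toSet, hh, ← mul_pow]
  rw [movingAvg, ← Cube.avg_sub_const (hF.mono_set hPR)]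
  refine (Cube.abs_avg_le _ _).trans (Cube.avgAbs_le ?_)
  refine (setIntegral_mono_set (Cube.integrableOn_abs_sub_const hF c)
      (Eventually.of_forall fun _ => abs_nonneg _) hPR.eventuallyLE).trans (h.trans_eq ?_)
  rw [hV]
  ring

end movingAvg

/-- A bounded function of small mean oscillation on cubes of half-side `2r` is close to its moving
average, in the mean over every cube of half-side at least `r`. -/
theorem setIntegral_abs_sub_movingAvg_le {r : ℝ} (hr : 0 < r) {F : (Fin n → ℝ) → ℝ}
    (hFi : ∀ Q : Cube n, IntegrableOn F Q.toSet)
    (hhi : ∀ Q : Cube n, IntegrableOn (movingAvg hr F) Q.toSet) {κ : ℝ}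
    (hF : ∀ Q : Cube n, Q.half = 2 * r → ∃ c,
      ∫ x in Q.toSet, |F x - c| ≤ κ * volume.real Q.toSet) {Q : Cube n} (hQ : r ≤ Q.half) :
    ∫ x in Q.toSet, |F x - movingAvg hr F x| ≤ (4 ^ n + 2 ^ n) * κ * volume.real Q.toSet := by
  rw [Q.volume_real_toSet]
  refine setIntegral_closedBall_le_of_tiles hr hQ (fun _ => abs_nonneg _)
    ((hFi Q).sub (hhi Q)).abs fun y q hq1 hq2 _ => ?_
  have hq : 0 < q := by linarith
  let R : Cube n := ⟨y, q, hq⟩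
  let S : Cube n := ⟨y, 2 * r, by positivity⟩
  have hRS : R.toSet ⊆ S.toSet := closedBall_subset_closedBall (show q ≤ 2 * r by linarith)
  obtain ⟨c, hc⟩ := hF S rfl
  have hκ : 0 ≤ κ := by
    have h1 : 0 ≤ ∫ x in S.toSet, |F x - c| := integral_nonneg fun _ => abs_nonneg _
    exact nonneg_of_mul_nonneg_left (h1.trans hc) S.volume_real_toSet_pos
  have hV : volume.real S.toSet ≤ 4 ^ n * volume.real R.toSet := by
    rw [S.volume_real_toSet, R.volume_real_toSet, ← mul_pow]
    exact pow_le_pow_left₀ (by simp only [S]; positivity) (by simp only [S, R]; linarith) n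
  have h1 : ∫ x in R.toSet, |F x - c| ≤ 4 ^ n * κ * volume.real R.toSet := by
    refine (setIntegral_mono_set (Cube.integrableOn_abs_sub_const (hFi S) c)
      (Eventually.of_forall fun _ => abs_nonneg _) hRS.eventuallyLE).trans (hc.trans ?_)
    calc κ * volume.real S.toSet ≤ κ * (4 ^ n * volume.real R.toSet) := by gcongr
      _ = _ := by ring
  have h2 : ∫ x in R.toSet, |movingAvg hr F x - c| ≤ 2 ^ n * κ * volume.real R.toSet := by
    refine Cube.setIntegral_abs_le_of_forall fun x hx => ?_
    exact abs_movingAvg_sub_const_le hr (Q := R) (R := S) hq2 rfl rfl (hFi S) hc hx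
  have h3 := Cube.setIntegral_abs_le_add (u := fun x => F x - movingAvg hr F x)
    (v := fun x => F x - c) (w := fun x => movingAvg hr F x - c)
    ((hFi R).sub (R.integrableOn_const c)) ((hhi R).sub (R.integrableOn_const c))
    (fun x _ => by simpa using abs_sub (F x - c) (movingAvg hr F x - c)) h1 h2
  rw [R.volume_real_toSet] at h3
  calc _ ≤ _ := h3
    _ = _ := by simp only [R]; ring

/-- The constant in the approximation by Lipschitz functions. -/
def approxConst (n : ℕ) : ℝ := (2 + 4 ^ n + 2 * 2 ^ n) * (2 + 2 * n)

/-- Approximation by bounded Lipschitz functions supported away from the boundary. -/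
theorem exists_lipschitz_approx (hn : 0 < n) {U : Set (Fin n → ℝ)} (hU : IsOpen U)
    {f : (Fin n → ℝ) → ℝ} (hf : ∀ Q : Cube n, Q.toSet ⊆ U → IntegrableOn f Q.toSet)
    {s ε M : ℝ} (hs : 0 < s) (hε : 0 < ε)
    (hosc : ∀ Q : Cube n, Q.toSet ⊆ U → Q.side < s → Q.osc f ≤ ε)
    (havg : ∀ Q : Cube n, Q.toSet ⊆ U → s / 8 ≤ Q.side → Q.avgAbs f ≤ M) :
    ∃ h : (Fin n → ℝ) → ℝ, BoundedOn U h ∧ LipschitzOn U h ∧ SuppAway U h ∧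
      (∀ Q : Cube n, Q.toSet ⊆ U → Q.osc (f - h) ≤ 2 * (approxConst n * ε)) ∧
      ∀ Q : Cube n, Q.toSet ⊆ U → s ≤ Q.side → Q.avgAbs (f - h) ≤ approxConst n * ε := by
  obtain ⟨F, δ, hδ, hFm, ⟨B, hFB⟩, hFδ, hFs, hfFs, hfFl⟩ :=
    exists_truncation hn hU hf hs hε hosc havg
  set κ : ℝ := (2 + 2 * n) * ε with hκ
  have hκ0 : 0 ≤ κ := by positivity
  have hεκ : ε ≤ κ := by rw [hκ]; nlinarith [(Nat.cast_nonneg n : (0 : ℝ) ≤ n)]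
  have hCκ : approxConst n * ε = (2 + 4 ^ n + 2 * 2 ^ n) * κ := by rw [approxConst, hκ]; ring
  rw [hCκ]
  have hB0 : 0 ≤ B := (abs_nonneg _).trans (hFB 0)
  set r : ℝ := min s δ / 16 with hr'
  have hr : 0 < r := by have := lt_min hs hδ; positivity
  have hrs : r ≤ s / 16 := by rw [hr']; gcongr; exact min_le_left _ _
  have hrδ : r ≤ δ / 16 := by rw [hr']; gcongr; exact min_le_right _ _
  set h := movingAvg hr F with hh
  have hhB : ∀ x, |h x| ≤ B := abs_movingAvg_le hr hFB
  have hhL : LipschitzWith (Real.toNNReal (2 * B * n / r)) h := by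
    refine LipschitzWith.of_dist_le_mul fun x y => ?_
    rw [Real.dist_eq, Real.coe_toNNReal _ (by positivity)]
    exact abs_movingAvg_sub_le hr hn hFm hFB x y
  have hFi := Cube.integrableOn_of_bounded hFm hFB
  have hhi := Cube.integrableOn_of_bounded hhL.continuous.aestronglyMeasurable hhB
  have hFall : ∀ Q : Cube n, Q.half = 2 * r → ∃ c,
      ∫ x in Q.toSet, |F x - c| ≤ κ * volume.real Q.toSet := by
    intro Q hQ
    by_cases hQU : Q.toSet ⊆ U
    · exact hFs Q hQU (by simp only [Cube.side]; linarith)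
    · obtain ⟨y, hyQ, hyU⟩ := Set.not_subset.1 hQU
      refine ⟨0, ?_⟩
      have hz : ∫ x in Q.toSet, |F x - 0| = 0 := by
        refine setIntegral_eq_zero_of_forall_eq_zero fun x hx => ?_
        by_contra hne
        have h1 := hFδ x (by simpa using hne) y hyU
        have h2 := dist_triangle_right x y Q.center
        have h3 : dist x Q.center ≤ Q.half := hx
        have h4 : dist y Q.center ≤ Q.half := hyQ
        linarith
      rw [hz]
      positivity
  have hlarge : ∀ Q : Cube n, r ≤ Q.half → ∫ x in Q.toSet, |F x - h x| ≤
      (4 ^ n + 2 ^ n) * κ * volume.real Q.toSet := fun Q hQ =>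
    setIntegral_abs_sub_movingAvg_le hr hFi hhi hFall hQ
  have hi : ∀ Q : Cube n, Q.toSet ⊆ U → IntegrableOn (f - h) Q.toSet := fun Q hQ =>
    (hf Q hQ).sub (hhi Q)
  have h2n : (0 : ℝ) ≤ 2 ^ n * κ := by positivity
  have h4n : (0 : ℝ) ≤ 4 ^ n * κ := by positivity
  have havgAbs : ∀ Q : Cube n, Q.toSet ⊆ U → s ≤ Q.side →
      Q.avgAbs (f - h) ≤ (2 + 4 ^ n + 2 * 2 ^ n) * κ := by
    intro Q hQU hQs
    refine Cube.avgAbs_le ?_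
    have h1 := Cube.setIntegral_abs_le_add (u := f - h) ((hf Q hQU).sub (hFi Q))
      ((hFi Q).sub (hhi Q)) (fun x _ => ?_) (hfFl Q hQU hQs)
      (hlarge Q (by simp only [Cube.side] at hQs; linarith))
    · exact h1.trans_eq (by ring)
    · exact abs_sub_le (f x) (F x) (h x)
  refine ⟨h, ⟨B, fun x _ => hhB x⟩, ⟨_, hhL.lipschitzOnWith⟩, ⟨δ / 2, by positivity, ?_⟩, ?_,
    havgAbs⟩
  · intro x hx y hy
    obtain ⟨z, hz, hFz⟩ := exists_ne_zero_of_movingAvg_ne_zero hr hx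
    have hyU : y ∉ U := by
      rw [hU.frontier_eq] at hy
      exact hy.2
    have h1 := hFδ z hFz y hyU
    have h2 := dist_triangle z x y
    rw [mem_closedBall] at hz
    linarith
  · intro Q hQU
    have hV := Q.volume_real_toSet_pos
    rcases le_or_gt s Q.side with hQs | hQs
    · refine (Cube.osc_le_two_mul_avgAbs (hi Q hQU)).trans ?_
      have := havgAbs Q hQU hQs
      gcongr
    rcases le_or_gt r Q.half with hQr | hQr
    · obtain ⟨c, hc⟩ := hfFs Q hQU hQs
      refine Cube.osc_le (hi Q hQU) (c := c) ?_
      have h1 := Cube.setIntegral_abs_le_add (u := fun x => (f - h) x - c)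
        (((hf Q hQU).sub (hFi Q)).sub (Q.integrableOn_const c))
        ((hFi Q).sub (hhi Q)) (fun x _ => ?_) hc (hlarge Q hQr)
      · refine h1.trans ?_
        gcongr
        linarith
      · have := abs_add_le (f x - F x - c) (F x - h x)
        rwa [show f x - F x - c + (F x - h x) = (f - h) x - c by
          simp only [Pi.sub_apply]; ring] at this
    · let R : Cube n := ⟨Q.center, 2 * r, by positivity⟩
      obtain ⟨c, hc⟩ := hFall R rfl
      refine Cube.osc_le (hi Q hQU) (c := Q.avg f - c) ?_
      have h0 : ∫ x in Q.toSet, |f x - Q.avg f| ≤ ε * volume.real Q.toSet := by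
        rw [Q.osc_mul_volume]
        have := hosc Q hQU hQs
        gcongr
      have h2 : ∫ x in Q.toSet, |h x - c| ≤ 2 ^ n * κ * volume.real Q.toSet := by
        refine Cube.setIntegral_abs_le_of_forall fun x hx => ?_
        exact abs_movingAvg_sub_const_le hr (Q := Q) (R := R) hQr.le rfl rfl (hFi R) hc hx
      have h1 := Cube.setIntegral_abs_le_add (u := fun x => (f - h) x - (Q.avg f - c))
        (v := fun x => f x - Q.avg f) (w := fun x => h x - c)
        ((hf Q hQU).sub (Q.integrableOn_const _)) ((hhi Q).sub (Q.integrableOn_const c))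
        (fun x _ => ?_) h0 h2
      · refine h1.trans ?_
        gcongr
        linarith
      · have := abs_sub (f x - Q.avg f) (h x - c)
        rwa [show f x - Q.avg f - (h x - c) = (f - h) x - (Q.avg f - c) by
          simp only [Pi.sub_apply]; ring] at this

theorem omegaOn_nonneg (U : Set (Fin n → ℝ)) (f : (Fin n → ℝ) → ℝ) (t : ℝ) :
    0 ≤ omegaOn U f t :=
  Real.sSup_nonneg (by rintro _ ⟨Q, -, -, rfl⟩; exact Q.osc_nonneg f)

theorem bigAvgSup_nonneg (U : Set (Fin n → ℝ)) (lam : ℝ) (f : (Fin n → ℝ) → ℝ) :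
    0 ≤ bigAvgSup U lam f :=
  Real.sSup_nonneg (by rintro _ ⟨Q, -, -, rfl⟩; exact Q.avgAbs_nonneg f)

theorem bmoNorm_nonneg (U : Set (Fin n → ℝ)) (lam : ℝ) (f : (Fin n → ℝ) → ℝ) :
    0 ≤ bmoNorm U lam f :=
  add_nonneg (omegaOn_nonneg U f lam) (bigAvgSup_nonneg U lam f)

theorem Cube.osc_le_omegaOn {U : Set (Fin n → ℝ)} {f : (Fin n → ℝ) → ℝ} {t lam : ℝ}
    (hbdd : BddAbove {r | ∃ Q : Cube n, Q.toSet ⊆ U ∧ Q.side < lam ∧ r = Q.osc f})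
    (ht : t ≤ lam) {Q : Cube n} (hQ : Q.toSet ⊆ U) (hQt : Q.side < t) :
    Q.osc f ≤ omegaOn U f t := by
  refine le_csSup (hbdd.mono ?_) ⟨Q, hQ, hQt, rfl⟩
  rintro _ ⟨R, hR, hRt, rfl⟩
  exact ⟨R, hR, hRt.trans_le ht, rfl⟩

/-- A function of vanishing mean oscillation whose means are bounded at every scale is approximable
by bounded Lipschitz functions supported away from the boundary. -/
theorem exists_lipschitz_tendsto_of_vanishSmallOsc (hn : 0 < n) {U : Set (Fin n → ℝ)}
    (hU : IsOpen U) {lam : ℝ} (hlam : 0 < lam) {f : (Fin n → ℝ) → ℝ}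
    (hf : ∀ lam', 0 < lam' → lam' ≤ lam → MemBmo U lam' f) (hv : VanishSmallOsc U f) :
    ∃ g : ℕ → (Fin n → ℝ) → ℝ,
      (∀ j, BoundedOn U (g j) ∧ LipschitzOn U (g j) ∧ SuppAway U (g j)) ∧
      Tendsto (fun j => bmoNorm U lam (f - g j)) atTop (nhds 0) := by
  have hC : 0 ≤ approxConst n := by unfold approxConst; positivity
  have key : ∀ ε > 0, ∃ h : (Fin n → ℝ) → ℝ,
      (BoundedOn U h ∧ LipschitzOn U h ∧ SuppAway U h) ∧
      bmoNorm U lam (f - h) ≤ 3 * approxConst n * ε := by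
    intro ε hε
    have h1 : ∀ᶠ t in nhdsWithin (0 : ℝ) (Set.Ioi 0), omegaOn U f t < ε ∧ t ∈ Set.Ioc 0 lam :=
      (hv.eventually_lt_const hε).and (Ioc_mem_nhdsGT hlam)
    obtain ⟨s, hsε, hs0, hsl⟩ := h1.exists
    obtain ⟨M, hM⟩ := (hf (s / 8) (by positivity) (by linarith)).2.2
    obtain ⟨hi, hb, -⟩ := hf lam hlam le_rfl
    obtain ⟨h, hB, hL, hS, hosc, havg⟩ := exists_lipschitz_approx hn hU hi hs0 hε (M := M)
      (fun Q hQ hQs => (Cube.osc_le_omegaOn hb hsl hQ hQs).trans hsε.le)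
      (fun Q hQ hQs => hM ⟨Q, hQ, hQs, rfl⟩)
    have hCε : 0 ≤ approxConst n * ε := by positivity
    refine ⟨h, ⟨hB, hL, hS⟩, ?_⟩
    have e1 : omegaOn U (f - h) lam ≤ 2 * (approxConst n * ε) :=
      Real.sSup_le (by rintro _ ⟨Q, hQ, -, rfl⟩; exact hosc Q hQ) (by positivity)
    have e2 : bigAvgSup U lam (f - h) ≤ approxConst n * ε :=
      Real.sSup_le (by rintro _ ⟨Q, hQ, hQl, rfl⟩; exact havg Q hQ (hsl.trans hQl)) hCε
    rw [bmoNorm]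
    linarith
  choose g hg hgn using fun j : ℕ => key (1 / ((j : ℝ) + 1)) (by positivity)
  refine ⟨g, hg, squeeze_zero (fun j => bmoNorm_nonneg _ _ _) hgn ?_⟩
  simpa using tendsto_one_div_add_atTop_nhds_zero_nat.const_mul (3 * approxConst n)

theorem LipschitzOn.uniformContinuousOn {U : Set (Fin n → ℝ)} {g : (Fin n → ℝ) → ℝ}
    (hg : LipschitzOn U g) : UniformContinuousOn g U :=
  let ⟨_, hK⟩ := hg
  hK.uniformContinuousOn

/-- A limit in `bmo` of bounded uniformly continuous functions has vanishing mean oscillation. -/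
theorem vanishSmallOsc_of_tendsto {U : Set (Fin n → ℝ)} {lam : ℝ} (hlam : 0 < lam)
    {f : (Fin n → ℝ) → ℝ} (hf : MemBmo U lam f) {g : ℕ → (Fin n → ℝ) → ℝ}
    (hg : ∀ j, BoundedOn U (g j) ∧ UniformContinuousOn (g j) U)
    (hlim : Tendsto (fun j => bmoNorm U lam (f - g j)) atTop (nhds 0)) :
    VanishSmallOsc U f := by
  obtain ⟨hfi, ⟨A, hA⟩, -⟩ := hf
  rw [VanishSmallOsc, Metric.tendsto_nhds]
  intro ε hε
  obtain ⟨j, hj⟩ := (hlim.eventually_lt_const (show (0 : ℝ) < ε / 8 by positivity)).exists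
  obtain ⟨⟨B, hB⟩, huc⟩ := hg j
  obtain ⟨δ, hδ, hgδ⟩ := Metric.uniformContinuousOn_iff.1 huc (ε / 8) (by positivity)
  have hgi : ∀ Q : Cube n, Q.toSet ⊆ U → IntegrableOn (g j) Q.toSet := fun Q hQ =>
    (huc.continuousOn.mono hQ).integrableOn_compact (isCompact_closedBall _ _)
  have hfgi : ∀ Q : Cube n, Q.toSet ⊆ U → IntegrableOn (f - g j) Q.toSet := fun Q hQ =>
    (hfi Q hQ).sub (hgi Q hQ)
  have hbdd : BddAbove {r | ∃ Q : Cube n, Q.toSet ⊆ U ∧ Q.side < lam ∧ r = Q.osc (f - g j)} := by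
    refine ⟨2 * (A + B), ?_⟩
    rintro _ ⟨Q, hQ, hQl, rfl⟩
    refine Cube.osc_le (hfgi Q hQ) (c := Q.avg f) ?_
    refine Cube.setIntegral_abs_le_add (v := fun x => f x - Q.avg f) (w := g j)
      ((hfi Q hQ).sub (Q.integrableOn_const _)) (hgi Q hQ) (fun x _ => ?_) ?_
      (Cube.setIntegral_abs_le_of_forall fun x hx => hB x (hQ hx))
    · have := abs_sub (f x - Q.avg f) (g j x)
      rwa [sub_right_comm] at this
    · rw [Q.osc_mul_volume]
      exact mul_le_mul_of_nonneg_right (hA ⟨Q, hQ, hQl, rfl⟩) measureReal_nonneg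
  have hosc : ∀ Q : Cube n, Q.toSet ⊆ U → Q.side < min lam δ → Q.osc f ≤ ε / 2 := by
    intro Q hQ hQs
    obtain ⟨hQl, hQδ⟩ := lt_min_iff.1 hQs
    have h1 : Q.osc (f - g j) ≤ ε / 8 := by
      refine (Cube.osc_le_omegaOn hbdd le_rfl hQ hQl).trans ?_
      have := bigAvgSup_nonneg U lam (f - g j)
      rw [bmoNorm] at hj
      linarith
    have hc : Q.center ∈ Q.toSet := mem_closedBall_self Q.half_pos.le
    have h2 : ∫ x in Q.toSet, |g j x - g j Q.center| ≤ ε / 8 * volume.real Q.toSet := by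
      refine Cube.setIntegral_abs_le_of_forall fun x hx => ?_
      rw [← Real.dist_eq]
      refine (hgδ x (hQ hx) _ (hQ hc) ?_).le
      have h3 : dist x Q.center ≤ Q.half := hx
      have := Q.half_pos
      simp only [Cube.side] at hQδ
      linarith
    have h4 := Cube.osc_le (hfi Q hQ) (c := Q.avg (f - g j) + g j Q.center)
      (Cube.setIntegral_abs_le_add (v := fun x => (f - g j) x - Q.avg (f - g j))
        (w := fun x => g j x - g j Q.center)
        ((hfgi Q hQ).sub (Q.integrableOn_const _)) ((hgi Q hQ).sub (Q.integrableOn_const _))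
        (fun x _ => ?_) (Q.osc_mul_volume _).le h2)
    · linarith
    · have := abs_add_le ((f - g j) x - Q.avg (f - g j)) (g j x - g j Q.center)
      rwa [show (f - g j) x - Q.avg (f - g j) + (g j x - g j Q.center) =
        f x - (Q.avg (f - g j) + g j Q.center) by simp only [Pi.sub_apply]; ring] at this
  filter_upwards [Ioc_mem_nhdsGT (lt_min hlam hδ)] with t ht
  rw [Real.dist_eq, sub_zero, abs_of_nonneg (omegaOn_nonneg _ _ _)]
  refine lt_of_le_of_lt (Real.sSup_le ?_ (by positivity)) (half_lt_self hε)
  rintro _ ⟨Q, hQ, hQt, rfl⟩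
  exact hosc Q hQ (hQt.trans_le ht.2)

/-- Theorem (approximation in vmo on a domain): if membership in bmo_{λ'}(Ω) is
independent of λ' ≤ λ, then for f ∈ bmo_λ(Ω), vanishing mean oscillation is
equivalent to approximability by bounded uniformly continuous functions, by
bounded Lipschitz functions, and by bounded Lipschitz functions supported away
from the boundary. -/
theorem stmt0 {n : ℕ} (hn : 0 < n) (Ω : Set (Fin n → ℝ)) (hΩ : IsRealDomain Ω)
    (lam : ℝ) (hlam : 0 < lam)
    (hscales : ∀ lam' : ℝ, 0 < lam' → lam' ≤ lam →
      ∀ g : (Fin n → ℝ) → ℝ, MemBmo Ω lam' g ↔ MemBmo Ω lam g)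
    (f : (Fin n → ℝ) → ℝ) (hf : MemBmo Ω lam f) :
    (VanishSmallOsc Ω f ↔
      ∃ g : ℕ → (Fin n → ℝ) → ℝ,
        (∀ j, BoundedOn Ω (g j) ∧ UniformContinuousOn (g j) Ω) ∧
        Tendsto (fun j => bmoNorm Ω lam (f - g j)) atTop (nhds 0)) ∧
    (VanishSmallOsc Ω f ↔
      ∃ g : ℕ → (Fin n → ℝ) → ℝ,
        (∀ j, BoundedOn Ω (g j) ∧ LipschitzOn Ω (g j)) ∧
        Tendsto (fun j => bmoNorm Ω lam (f - g j)) atTop (nhds 0)) ∧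
    (VanishSmallOsc Ω f ↔
      ∃ g : ℕ → (Fin n → ℝ) → ℝ,
        (∀ j, BoundedOn Ω (g j) ∧ LipschitzOn Ω (g j) ∧ SuppAway Ω (g j)) ∧
        Tendsto (fun j => bmoNorm Ω lam (f - g j)) atTop (nhds 0)) := by
  have hba := @vanishSmallOsc_of_tendsto n Ω lam hlam f hf
  have had := exists_lipschitz_tendsto_of_vanishSmallOsc hn hΩ.1 hlam
    (fun lam' h0 h1 => (hscales lam' h0 h1 f).2 hf)
  refine ⟨⟨fun h => ?_, fun ⟨g, hg, hlim⟩ => hba hg hlim⟩, ⟨fun h => ?_, fun ⟨g, hg, hlim⟩ =>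
    hba (fun j => ⟨(hg j).1, (hg j).2.uniformContinuousOn⟩) hlim⟩, had, fun ⟨g, hg, hlim⟩ =>
    hba (fun j => ⟨(hg j).1, (hg j).2.1.uniformContinuousOn⟩) hlim⟩
  · obtain ⟨g, hg, hlim⟩ := had h
    exact ⟨g, fun j => ⟨(hg j).1, (hg j).2.1.uniformContinuousOn⟩, hlim⟩
  · obtain ⟨g, hg, hlim⟩ := had h
    exact ⟨g, fun j => ⟨(hg j).1, (hg j).2.1⟩, hlim⟩
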